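/- arXiv:2105.00422 — 5 statements merged into one kernel-verified Lean document; each statement's English description precedes it below -/
import Mathlib

section
/- Let P be a submonoid of a group G, let m ≥ 1, let p₁, q₁, …, p_m, q_m ∈ P, and let X ⊆ P be any subset. Then q₁⁻¹p₁ ⋯ q_m⁻¹p_m p_m⁻¹q_m ⋯ p₁⁻¹q₁ X = (q₁⁻¹p₁ ⋯ q_m⁻¹p_m P) ∩ X, where each expression is evaluated by applying the operations Y ↦ rY and Y ↦ r⁻¹Y iteratively from the right. -/
noncomputable section

open ContinuousLinearMap
open scoped Classical

variable {G : Type*} [Group G]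

/-- The Hilbert space ℓ²(P). -/
abbrev l2 (P : Submonoid G) : Type _ := lp (fun _ : P => ℂ) 2

/-- The standard orthonormal basis vector δ_s of ℓ²(P). -/
def delta (P : Submonoid G) (s : P) : l2 P :=
  letI := Classical.decEq P
  lp.single 2 s 1

/-- The set pX = {px : x ∈ X}. -/
def lmul (P : Submonoid G) (p : P) (X : Set P) : Set P := (fun x => p * x) '' X

/-- The set p⁻¹X = {y ∈ P : py ∈ X}. -/
def linv (P : Submonoid G) (p : P) (X : Set P) : Set P := {y : P | p * y ∈ X}

/-- The set p₁⁻¹q₁ ⋯ pₙ⁻¹qₙ X, the operations being applied iteratively from the right;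
the word is encoded as the list [(p₁,q₁),…,(pₙ,qₙ)]. -/
def wordSet (P : Submonoid G) (l : List (P × P)) (X : Set P) : Set P :=
  l.foldr (fun a Y => linv P a.1 (lmul P a.2 Y)) X

/-- The operator V_{p₁}* V_{q₁} ⋯ V_{pₙ}* V_{qₙ} on ℓ²(P), the word being encoded as the
list [(p₁,q₁),…,(pₙ,qₙ)]. -/
def opWord (P : Submonoid G) (V : P → (l2 P →L[ℂ] l2 P)) (l : List (P × P)) :
    l2 P →L[ℂ] l2 P :=
  (l.map fun a => (ContinuousLinearMap.adjoint (V a.1)) * (V a.2)).prod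

/-- The group element p₁⁻¹q₁ ⋯ pₙ⁻¹qₙ of G. -/
def grpWord (P : Submonoid G) (l : List (P × P)) : G :=
  (l.map fun a => ((a.1 : G))⁻¹ * (a.2 : G)).prod


theorem mem_linv_lmul_iff (P : Submonoid G) (p q : P) (X : Set P) (y : P) :
    y ∈ linv P q (lmul P p X) ↔ ∃ x ∈ X, p * x = q * y :=
  Iff.rfl

theorem linv_lmul_inter_linv_lmul (P : Submonoid G) (p q : P) (W X : Set P) :
    linv P q (lmul P p (W ∩ linv P p (lmul P q X))) = linv P q (lmul P p W) ∩ X := by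
  ext y
  simp only [Set.mem_inter_iff, mem_linv_lmul_iff]
  constructor
  · rintro ⟨w, ⟨hw, x, hx, hxw⟩, hwy⟩
    obtain rfl : x = y := mul_left_cancel (hxw.trans hwy)
    exact ⟨⟨w, hw, hwy⟩, hx⟩
  · rintro ⟨⟨w, hw, hwy⟩, hy⟩
    exact ⟨w, ⟨hw, y, hy, hwy.symm⟩, hwy⟩

theorem wordSet_map_swap_foldl (P : Submonoid G) (l : List (P × P)) (X : Set P) :
    wordSet P (l.map Prod.swap) (l.foldl (fun Y a => linv P a.1 (lmul P a.2 Y)) X)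
      = wordSet P (l.map Prod.swap) Set.univ ∩ X := by
  induction l generalizing X with
  | nil => simp [wordSet]
  | cons a l ih =>
    have h := congrArg (fun Y => linv P a.2 (lmul P a.1 Y)) (ih (linv P a.1 (lmul P a.2 X)))
    exact h.trans (linv_lmul_inter_linv_lmul P a.1 a.2 _ X)

/-- q₁⁻¹p₁ ⋯ q_m⁻¹p_m p_m⁻¹q_m ⋯ p₁⁻¹q₁ X = (q₁⁻¹p₁ ⋯ q_m⁻¹p_m P) ∩ X. -/
theorem stmt0 (P : Submonoid G) (m : ℕ) (hm : 1 ≤ m) (p q : Fin m → P) (X : Set P) :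
    wordSet P (List.ofFn fun i => (q i, p i))
        ((List.ofFn fun i => (p i, q i)).foldl (fun Y a => linv P a.1 (lmul P a.2 Y)) X)
      = wordSet P (List.ofFn fun i => (q i, p i)) Set.univ ∩ X := by
  simpa [List.map_ofFn, Function.comp_def] using
    wordSet_map_swap_foldl P (List.ofFn fun i => (p i, q i)) X
end
end

section
/- Let P be a submonoid of a group G. The collection 𝒥 of constructible right ideals of P is closed under intersection: if 𝐱, 𝐲 ∈ 𝒥 then 𝐱 ∩ 𝐲 ∈ 𝒥. -/
noncomputable section

open ContinuousLinearMap
open scoped Classical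

variable {G : Type*} [Group G]

/-- A constructible right ideal of P: a set of the form p₁⁻¹q₁ ⋯ pₙ⁻¹qₙ P (n ≥ 0), or ∅. -/
def IsConstructible (P : Submonoid G) (A : Set P) : Prop :=
  (∃ (n : ℕ) (p q : Fin n → P),
      A = wordSet P (List.ofFn fun i => (p i, q i)) Set.univ) ∨ A = ∅

theorem linv_lmul_inter (P : Submonoid G) (p q : P) (Y Z : Set P) :
    linv P p (lmul P q (linv P q (lmul P p Y) ∩ Z)) = Y ∩ linv P p (lmul P q Z) := by
  ext y
  constructor
  · rintro ⟨x, ⟨⟨z, hz, hzx⟩, hx⟩, hxy⟩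
    obtain rfl : z = y := mul_left_cancel (hzx.trans hxy)
    exact ⟨hz, x, hx, hxy⟩
  · rintro ⟨hy, x, hx, hxy⟩
    exact ⟨x, ⟨⟨y, hy, hxy.symm⟩, hx⟩, hxy⟩

theorem wordSet_append (P : Submonoid G) (l m : List (P × P)) (X : Set P) :
    wordSet P (l ++ m) X = wordSet P l (wordSet P m X) :=
  List.foldr_append

theorem wordSet_wordSet_reverse_swap (P : Submonoid G) (l : List (P × P)) (Y : Set P) :
    wordSet P l (wordSet P (l.map Prod.swap).reverse Y) = Y ∩ wordSet P l Set.univ := by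
  induction l generalizing Y with
  | nil => exact (Set.inter_univ Y).symm
  | cons a l ih =>
    rw [List.map_cons, List.reverse_cons, wordSet_append]
    change linv P a.1 (lmul P a.2 (wordSet P l (wordSet P _ _))) = _
    rw [ih]
    exact linv_lmul_inter P a.1 a.2 Y _

theorem isConstructible_wordSet (P : Submonoid G) (l : List (P × P)) :
    IsConstructible P (wordSet P l Set.univ) :=
  Or.inl ⟨l.length, fun i => (l.get i).1, fun i => (l.get i).2, by simp⟩

/-- The collection 𝒥 of constructible right ideals is closed under intersection. -/
theorem stmt1 (P : Submonoid G) (X Y : Set P)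
    (hX : IsConstructible P X) (hY : IsConstructible P Y) :
    IsConstructible P (X ∩ Y) := by
  rcases hX with ⟨n, p, q, rfl⟩ | rfl
  · rcases hY with ⟨m, r, s, rfl⟩ | rfl
    · rw [← wordSet_wordSet_reverse_swap, ← wordSet_append, ← wordSet_append]
      exact isConstructible_wordSet P _
    · exact Or.inr (Set.inter_empty _)
  · exact Or.inr (Set.empty_inter _)
end
end

section
/- Let P be a submonoid of a group G and let p₁, q₁, …, p_n, q_n ∈ P. Then V_{p₁}* V_{q₁} ⋯ V_{p_n}* V_{q_n} · V_{q_n}* V_{p_n} ⋯ V_{q₁}* V_{p₁} = E_{[p₁⁻¹q₁ ⋯ p_n⁻¹q_n P]} as bounded operators on ℓ²(P), where p₁⁻¹q₁ ⋯ p_n⁻¹q_n P is the subset of P obtained by applying the operations Y ↦ rY and Y ↦ r⁻¹Y iteratively from the right. -/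
noncomputable section

open ContinuousLinearMap
open scoped Classical

variable {G : Type*} [Group G]

lemma clm_ext_delta (P : Submonoid G) {S T : l2 P →L[ℂ] l2 P}
    (h : ∀ s, S (delta P s) = T (delta P s)) : S = T := by
  refine lp.ext_continuousLinearMap (by norm_num) fun s => ContinuousLinearMap.ext_ring ?_
  have hs : lp.single 2 s (1 : ℂ) = delta P s := by
    unfold delta
    congr!
  simpa only [ContinuousLinearMap.comp_apply, lp.singleContinuousLinearMap_apply, hs] using h s

lemma inner_delta (P : Submonoid G) (t : P) (f : l2 P) : inner ℂ (delta P t) f = f t := by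
  simp [delta, lp.inner_single_left]

lemma delta_apply (P : Submonoid G) (s t : P) : delta P s t = if t = s then 1 else 0 := by
  simp [delta, lp.single_apply, Pi.single_apply]

lemma adjoint_delta (P : Submonoid G) {p : P} {T : l2 P →L[ℂ] l2 P}
    (hT : ∀ s, T (delta P s) = delta P (p * s)) (s t : P) :
    adjoint T (delta P s) t = if p * t = s then 1 else 0 := by
  rw [← inner_delta, adjoint_inner_right, hT, inner_delta, delta_apply]

lemma adjoint_delta_mul (P : Submonoid G) {p : P} {T : l2 P →L[ℂ] l2 P}
    (hT : ∀ s, T (delta P s) = delta P (p * s)) (s : P) :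
    adjoint T (delta P (p * s)) = delta P s := by
  ext t
  rw [adjoint_delta P hT, delta_apply]
  simp

lemma adjoint_delta_of_notMem (P : Submonoid G) {p : P} {T : l2 P →L[ℂ] l2 P}
    (hT : ∀ s, T (delta P s) = delta P (p * s)) {s : P} (hs : ∀ t, p * t ≠ s) :
    adjoint T (delta P s) = 0 := by
  ext t
  rw [adjoint_delta P hT]
  simp [hs t]

lemma isometry_conj_proj (P : Submonoid G)
    {V : P → (l2 P →L[ℂ] l2 P)} {E : Set P → (l2 P →L[ℂ] l2 P)}
    (hV : ∀ p s : P, V p (delta P s) = delta P (p * s))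
    (hE : ∀ (X : Set P) (s : P), E X (delta P s) = if s ∈ X then delta P s else 0)
    (p : P) (X : Set P) :
    V p * E X * adjoint (V p) = E (lmul P p X) := by
  refine clm_ext_delta P fun s => ?_
  by_cases hs : ∃ t, p * t = s
  · obtain ⟨t, rfl⟩ := hs
    have hmem : p * t ∈ lmul P p X ↔ t ∈ X := by simp [lmul]
    simp only [mul_apply_eq_comp, adjoint_delta_mul P (hV p), hE, hmem]
    split_ifs <;> simp [hV]
  · push Not at hs
    have hmem : s ∉ lmul P p X := fun ⟨t, _, ht⟩ => hs t ht
    simp [adjoint_delta_of_notMem P (hV p) hs, hE, hmem]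

lemma coisometry_conj_proj (P : Submonoid G)
    {V : P → (l2 P →L[ℂ] l2 P)} {E : Set P → (l2 P →L[ℂ] l2 P)}
    (hV : ∀ p s : P, V p (delta P s) = delta P (p * s))
    (hE : ∀ (X : Set P) (s : P), E X (delta P s) = if s ∈ X then delta P s else 0)
    (p : P) (X : Set P) :
    adjoint (V p) * E X * V p = E (linv P p X) := by
  refine clm_ext_delta P fun s => ?_
  have hmem : s ∈ linv P p X ↔ p * s ∈ X := Iff.rfl
  simp only [mul_apply_eq_comp, hV, hE, hmem]
  split_ifs <;> simp [adjoint_delta_mul P (hV p)]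

lemma opWord_mul_opWord_swap_reverse (P : Submonoid G)
    {V : P → (l2 P →L[ℂ] l2 P)} {E : Set P → (l2 P →L[ℂ] l2 P)}
    (hV : ∀ p s : P, V p (delta P s) = delta P (p * s))
    (hE : ∀ (X : Set P) (s : P), E X (delta P s) = if s ∈ X then delta P s else 0)
    (l : List (P × P)) :
    opWord P V l * opWord P V (l.map Prod.swap).reverse = E (wordSet P l Set.univ) := by
  induction l with
  | nil =>
    refine clm_ext_delta P fun s => ?_
    simp [opWord, wordSet, hE]
  | cons a l ih =>
    have hset : wordSet P (a :: l) Set.univ =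
        linv P a.1 (lmul P a.2 (wordSet P l Set.univ)) := rfl
    rw [hset, ← coisometry_conj_proj P hV hE, ← isometry_conj_proj P hV hE, ← ih]
    simp [opWord, mul_assoc]

/-- V_{p₁}* V_{q₁} ⋯ V_{pₙ}* V_{qₙ} · V_{qₙ}* V_{pₙ} ⋯ V_{q₁}* V_{p₁} = E_{[p₁⁻¹q₁ ⋯ pₙ⁻¹qₙ P]}. -/
theorem stmt4 (P : Submonoid G)
    (V : P → (l2 P →L[ℂ] l2 P)) (E : Set P → (l2 P →L[ℂ] l2 P))
    (hV : ∀ p s : P, V p (delta P s) = delta P (p * s))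
    (hE : ∀ (X : Set P) (s : P), E X (delta P s) = if s ∈ X then delta P s else 0)
    (n : ℕ) (p q : Fin n → P) :
    opWord P V (List.ofFn fun i => (p i, q i)) *
        opWord P V ((List.ofFn fun i => (q i, p i)).reverse)
      = E (wordSet P (List.ofFn fun i => (p i, q i)) Set.univ) := by
  have hrev : (List.ofFn fun i => (q i, p i)) =
      (List.ofFn fun i => (p i, q i)).map Prod.swap := by
    rw [List.map_ofFn]; rfl
  rw [hrev, opWord_mul_opWord_swap_reverse P hV hE]
end
end

section
/- Let P be a submonoid of a group G that generates G as a group. Then pP ∩ qP ≠ ∅ for all p, q ∈ P (i.e., P is left reversible) if and only if every element g ∈ G can be written as g = a b⁻¹ with a, b ∈ P (i.e., G = P P⁻¹). -/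
noncomputable section

open ContinuousLinearMap
open scoped Classical

variable {G : Type*} [Group G]

/-- If P generates G as a group, then P is left reversible if and only if G = P P⁻¹. -/
theorem stmt14 (P : Submonoid G) (hgen : Subgroup.closure (P : Set G) = ⊤) :
    (∀ p q : P, (lmul P p Set.univ ∩ lmul P q Set.univ).Nonempty)
      ↔ ∀ g : G, ∃ a b : P, g = (a : G) * (b : G)⁻¹ := by
  constructor
  · intro h g
    have hg : g ∈ Subgroup.closure (P : Set G) := hgen ▸ Subgroup.mem_top g
    induction hg using Subgroup.closure_induction with
    | mem x hx => exact ⟨⟨x, hx⟩, 1, by simp⟩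
    | one => exact ⟨1, 1, by simp⟩
    | mul x y _ _ hx hy =>
      obtain ⟨a, b, rfl⟩ := hx
      obtain ⟨c, d, rfl⟩ := hy
      obtain ⟨_, ⟨u, -, rfl⟩, ⟨v, -, hv⟩⟩ := h b c
      have huv : (c : G) * v = b * u := congrArg Subtype.val hv
      have hbc : (b : G)⁻¹ * c = u * (v : G)⁻¹ := by
        rw [inv_mul_eq_iff_eq_mul, ← mul_assoc, ← huv, mul_inv_cancel_right]
      refine ⟨a * u, d * v, ?_⟩
      calc (a : G) * (b : G)⁻¹ * (c * (d : G)⁻¹)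
          = a * ((b : G)⁻¹ * c) * (d : G)⁻¹ := by group
        _ = ((a * u : P) : G) * ((d * v : P) : G)⁻¹ := by
          rw [hbc, Submonoid.coe_mul, Submonoid.coe_mul]; group
    | inv x _ hx =>
      obtain ⟨a, b, rfl⟩ := hx
      exact ⟨b, a, by group⟩
  · intro h p q
    obtain ⟨a, b, hab⟩ := h ((p : G)⁻¹ * q)
    refine ⟨p * a, ⟨a, trivial, rfl⟩, ⟨b, trivial, Subtype.ext ?_⟩⟩
    change (q : G) * b = p * a
    rw [eq_mul_inv_iff_mul_eq, mul_assoc, inv_mul_eq_iff_eq_mul] at hab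
    exact hab
end
end

section
/- Let P be a submonoid of a group G such that every element of G can be written as a b⁻¹ with a, b ∈ P. Let H be a group and let φ : P → H be a monoid homomorphism. Then there exists a unique group homomorphism ψ : G → H such that ψ(p) = φ(p) for all p ∈ P. -/
noncomputable section

open ContinuousLinearMap
open scoped Classical

variable {G : Type*} [Group G]

/-- If `G = P P⁻¹`, the element `φ a * (φ b)⁻¹` depends only on `a * b⁻¹`. -/
theorem map_mul_inv_eq_of_mul_inv_eq {G H : Type*} [Group G] [Group H] {P : Submonoid G}
    (hPG : ∀ g : G, ∃ a b : P, g = (a : G) * (b : G)⁻¹) (φ : P →* H) {a b c d : P}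
    (h : (a : G) * (b : G)⁻¹ = c * (d : G)⁻¹) : φ a * (φ b)⁻¹ = φ c * (φ d)⁻¹ := by
  obtain ⟨x, y, hxy⟩ := hPG ((b : G)⁻¹ * d)
  have hbd : b * x = d * y := Subtype.ext <| by
    push_cast
    rw [eq_mul_inv_iff_mul_eq] at hxy
    rw [← hxy]
    group
  have hac : a * x = c * y := Subtype.ext <| by
    have hbd' : (b : G) * x = d * y := congrArg Subtype.val hbd
    calc (a : G) * x = a * (b : G)⁻¹ * (b * x) := by group
      _ = c * y := by rw [h, hbd']; group
  have hb := congrArg φ hbd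
  have ha := congrArg φ hac
  rw [map_mul, map_mul] at ha hb
  calc φ a * (φ b)⁻¹ = φ a * φ x * (φ b * φ x)⁻¹ := by group
    _ = φ c * (φ d)⁻¹ := by rw [ha, hb]; group

/-- If G = P P⁻¹ then every monoid homomorphism from P into a group H extends uniquely to
a group homomorphism G → H. -/
theorem stmt15 (P : Submonoid G) (hPG : ∀ g : G, ∃ a b : P, g = (a : G) * (b : G)⁻¹)
    {H : Type*} [Group H] (φ : P →* H) :
    ∃! ψ : G →* H, ∀ p : P, ψ (p : G) = φ p := by
  choose a b hab using hPG
  have key {g : G} {c d : P} (h : g = (c : G) * (d : G)⁻¹) :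
      φ (a g) * (φ (b g))⁻¹ = φ c * (φ d)⁻¹ :=
    map_mul_inv_eq_of_mul_inv_eq (fun g => ⟨a g, b g, hab g⟩) φ ((hab g).symm.trans h)
  refine ⟨MonoidHom.mk' (fun g => φ (a g) * (φ (b g))⁻¹) fun g h => ?_, fun p => ?_,
    fun ψ hψ => MonoidHom.ext fun g => ?_⟩
  · obtain ⟨x, y, hxy⟩ : ∃ x y : P, ((b g : P) : G)⁻¹ * a h = x * (y : G)⁻¹ := ⟨_, _, hab _⟩
    have hmul : g * h = ((a g * x : P) : G) * ((b h * y : P) : G)⁻¹ := by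
      calc g * h = a g * (((b g : P) : G)⁻¹ * a h) * ((b h : P) : G)⁻¹ := by
            conv_lhs => rw [hab g, hab h]
            group
        _ = _ := by rw [hxy]; push_cast; group
    have hφ : b g * x = a h * y := Subtype.ext <| by
      push_cast
      rw [eq_mul_inv_iff_mul_eq] at hxy
      rw [← hxy]
      group
    have hφ' := congrArg φ hφ
    rw [map_mul, map_mul, ← eq_inv_mul_iff_mul_eq] at hφ'
    rw [key hmul, map_mul, map_mul, hφ']
    group
  · have := key (g := (p : G)) (c := p) (d := 1) (by simp)
    simpa using this
  · change ψ g = φ (a g) * (φ (b g))⁻¹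
    conv_lhs => rw [hab g]
    rw [map_mul, map_inv, hψ, hψ]
end
end
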